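/- Fix a positive integer m > 0. Let T be an idempotent complete algebraic m-periodic triangulated category over a perfect field k such that Hom_T(X, Y) is finite dimensional over k for all objects X, Y ∈ T. If T_1 and T_2 are strict m-periodic tilting objects of T, then T_1 and T_2 have the same number of pairwise non-isomorphic indecomposable direct summands. -/

import Mathlib

open CategoryTheory CategoryTheory.Limits CategoryTheory.Pretriangulated

universe v u

attribute [local instance] CategoryTheory.isIsomorphicSetoid

/-- The isomorphism class of an object. -/
noncomputable def isoClass {C : Type*} [Category C] (X : C) :
    Quotient (CategoryTheory.isIsomorphicSetoid C) :=
  Quotient.mk _ X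

section ExactCategories

/-- An exact structure on an additive category: a class of kernel–cokernel pairs
("conflations"), closed under isomorphisms, satisfying Quillen's axioms. -/
structure ExactStructure (E : Type u) [Category.{v} E] [Preadditive E] where
  /-- the distinguished kernel-cokernel pairs -/
  conflations : Set (ShortComplex E)
  iso_closed : ∀ {S S' : ShortComplex E}, (S ≅ S') → S ∈ conflations → S' ∈ conflations
  kernel_of : ∀ S ∈ conflations, Nonempty (IsLimit (KernelFork.ofι S.f S.zero))
  cokernel_of : ∀ S ∈ conflations, Nonempty (IsColimit (CokernelCofork.ofπ S.g S.zero))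

namespace ExactStructure

variable {E : Type u} [Category.{v} E] [Preadditive E] (ex : ExactStructure E)

/-- Admissible monomorphisms (inflations). -/
def Inflation {X Y : E} (f : X ⟶ Y) : Prop :=
  ∃ (Z : E) (g : Y ⟶ Z) (w : f ≫ g = 0), ShortComplex.mk f g w ∈ ex.conflations

/-- Admissible epimorphisms (deflations). -/
def Deflation {Y Z : E} (g : Y ⟶ Z) : Prop :=
  ∃ (X : E) (f : X ⟶ Y) (w : f ≫ g = 0), ShortComplex.mk f g w ∈ ex.conflations

/-- Quillen's axioms for an exact structure. -/
structure IsExact : Prop where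
  infl_id : ∀ X : E, ex.Inflation (𝟙 X)
  defl_id : ∀ X : E, ex.Deflation (𝟙 X)
  infl_comp : ∀ {X Y Z : E} (f : X ⟶ Y) (g : Y ⟶ Z),
    ex.Inflation f → ex.Inflation g → ex.Inflation (f ≫ g)
  defl_comp : ∀ {X Y Z : E} (f : X ⟶ Y) (g : Y ⟶ Z),
    ex.Deflation f → ex.Deflation g → ex.Deflation (f ≫ g)
  pushout_infl : ∀ {X Y Z : E} (f : X ⟶ Y), ex.Inflation f → ∀ h : X ⟶ Z,
    ∃ (W : E) (k : Y ⟶ W) (g : Z ⟶ W), IsPushout f h k g ∧ ex.Inflation g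
  pullback_defl : ∀ {Y Z W : E} (g : Y ⟶ Z), ex.Deflation g → ∀ h : W ⟶ Z,
    ∃ (V : E) (p : V ⟶ W) (q : V ⟶ Y), IsPullback p q h g ∧ ex.Deflation p

/-- Projective objects relative to an exact structure. -/
def Proj (P : E) : Prop :=
  ∀ {Y Z : E} (g : Y ⟶ Z), ex.Deflation g → ∀ h : P ⟶ Z, ∃ l : P ⟶ Y, l ≫ g = h

/-- Injective objects relative to an exact structure. -/
def Inj (I : E) : Prop :=
  ∀ {X Y : E} (f : X ⟶ Y), ex.Inflation f → ∀ h : X ⟶ I, ∃ l : Y ⟶ I, f ≫ l = h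

/-- A Frobenius exact category: an exact category with enough projectives and enough
injectives in which the projective and the injective objects coincide. -/
structure IsFrobenius : Prop where
  isExact : ex.IsExact
  enough_proj : ∀ X : E, ∃ (P : E) (p : P ⟶ X), ex.Proj P ∧ ex.Deflation p
  enough_inj : ∀ X : E, ∃ (I : E) (i : X ⟶ I), ex.Inj I ∧ ex.Inflation i
  proj_iff_inj : ∀ X : E, ex.Proj X ↔ ex.Inj X

/-- Two maps are stably equal if their difference factors through a projective object. -/
def stableRel : HomRel E := fun {X Y} f g =>
  ∃ (P : E) (u : X ⟶ P) (v : P ⟶ Y), ex.Proj P ∧ f - g = u ≫ v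

/-- The stable category of a Frobenius exact category: the quotient of `E` by the ideal
of morphisms factoring through a projective(-injective) object. -/
abbrev StableCategory := CategoryTheory.Quotient ex.stableRel

end ExactStructure

/-- A `T` is an algebraic triangulated category if it is equivalent to the stable category
of a Frobenius exact category. -/
structure FrobeniusModel (T : Type u) [Category.{v} T] where
  E : Type u
  [instCat : Category.{v} E]
  [instPre : Preadditive E]
  ex : ExactStructure E
  frobenius : ex.IsFrobenius
  equivalence : ex.StableCategory ≌ T

/-- `T` is algebraic: it is (equivalent to) the stable category of a Frobenius exact
category. -/
def IsAlgebraicTriangulated (T : Type u) [Category.{v} T] : Prop :=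
  Nonempty (FrobeniusModel T)

end ExactCategories

section Tilting

variable {T : Type u} [Category.{v} T] [HasZeroObject T] [Preadditive T] [HasShift T ℤ]
  [∀ n : ℤ, (shiftFunctor T n).Additive] [Pretriangulated T]

/-- A class of objects is thick-triangulated-closed if it is closed under isomorphisms,
shifts, extensions (cones) and direct summands (retracts). -/
def IsThickClosed (P : T → Prop) : Prop :=
  (∀ X Y : T, Nonempty (X ≅ Y) → P X → P Y) ∧
  (∀ (X : T) (n : ℤ), P X → P (X⟦n⟧)) ∧
  (∀ Tr : Triangle T, Tr ∈ distinguishedTriangles → P Tr.obj₁ → P Tr.obj₂ → P Tr.obj₃) ∧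
  (∀ (X Z : T) (i : X ⟶ Z) (r : Z ⟶ X), i ≫ r = 𝟙 X → P Z → P X)

/-- `T₀` is an `m`-periodic tilting object: `Hom(T₀, Σ^i T₀) = 0` for `i ∉ mℤ` and the
smallest thick triangulated subcategory containing `T₀` is all of `T`. -/
def IsPeriodicTilting (m : ℕ) (T₀ : T) : Prop :=
  (∀ i : ℤ, ¬ ((m : ℤ) ∣ i) → ∀ f : T₀ ⟶ T₀⟦i⟧, f = 0) ∧
  (∀ P : T → Prop, IsThickClosed P → P T₀ → ∀ X : T, P X)

/-- Projective dimension `≤ n` in an abelian category, defined inductively. -/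
def pdLE (A : Type*) [Category A] [Abelian A] : ℕ → A → Prop
  | 0, X => Projective X
  | (n + 1), X => ∃ S : ShortComplex A, S.ShortExact ∧ Projective S.X₂ ∧
      Nonempty (S.X₃ ≅ X) ∧ pdLE A n S.X₁

/-- A strict `m`-periodic tilting object: an `m`-periodic tilting object whose
endomorphism algebra has global dimension `< m`. -/
def IsStrictPeriodicTilting (m : ℕ) (T₀ : T) : Prop :=
  IsPeriodicTilting m T₀ ∧
    ∀ M : ModuleCat.{v} (End T₀), pdLE (ModuleCat.{v} (End T₀)) (m - 1) M

/-- `X` is indecomposable: it is nonzero and its only idempotent endomorphisms are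
`0` and `𝟙 X`. -/
def IsIndecomposable (X : T) : Prop :=
  ¬ IsZero X ∧ ∀ e : X ⟶ X, e ≫ e = e → e = 0 ∨ e = 𝟙 X

/-- The number of isomorphism classes of indecomposable direct summands of `T₀`. -/
noncomputable def summandCount (T₀ : T) : ℕ :=
  Nat.card {S : _root_.Quotient (CategoryTheory.isIsomorphicSetoid T) //
    ∃ X : T, IsIndecomposable X ∧ (∃ (i : X ⟶ T₀) (r : T₀ ⟶ X), i ≫ r = 𝟙 X) ∧
      isoClass X = S}

end Tilting


set_option linter.unusedSectionVars false
set_option linter.style.haveILetI false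
set_option linter.unusedSimpArgs false

theorem unit_or_nil {k A : Type*} [Field k] [Ring A] [Algebra k A] [FiniteDimensional k A]
    (h : ∀ e : A, e * e = e → e = 0 ∨ e = 1) (u : A) : IsUnit u ∨ IsNilpotent u := by
  classical
  have hint : IsIntegral k u := Algebra.IsIntegral.isIntegral u
  have hp0 : minpoly k u ≠ 0 := minpoly.ne_zero hint
  obtain ⟨q, hq, hnd⟩ := Polynomial.exists_eq_pow_rootMultiplicity_mul_and_not_dvd
    (minpoly k u) hp0 0
  generalize Polynomial.rootMultiplicity 0 (minpoly k u) = a at hq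
  have hX : (Polynomial.X - Polynomial.C (0 : k)) = Polynomial.X := by simp
  rw [hX] at hq hnd
  have hcop : IsCoprime ((Polynomial.X : Polynomial k) ^ a) q := by
    apply IsCoprime.pow_left
    exact (Polynomial.irreducible_X.coprime_iff_not_dvd).2 hnd
  obtain ⟨s, t, hst⟩ := hcop
  have h1 : Polynomial.aeval u s * u ^ a + Polynomial.aeval u t * Polynomial.aeval u q = 1 := by
    have := congrArg (Polynomial.aeval u) hst
    simpa using this
  have h2 : u ^ a * Polynomial.aeval u q = 0 := by
    have := minpoly.aeval k u
    rw [hq] at this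
    simpa using this
  have hcomm : ∀ f g : Polynomial k,
      Polynomial.aeval u f * Polynomial.aeval u g = Polynomial.aeval u g * Polynomial.aeval u f := by
    intro f g
    rw [← map_mul, mul_comm, map_mul]
  have hua : u ^ a = Polynomial.aeval u ((Polynomial.X : Polynomial k) ^ a) := by simp
  have hid : (Polynomial.aeval u s * u ^ a) * (Polynomial.aeval u s * u ^ a)
      = Polynomial.aeval u s * u ^ a := by
    have h3 : Polynomial.aeval u s * u ^ a * (Polynomial.aeval u t * Polynomial.aeval u q) = 0 := by
      rw [hcomm t q, mul_assoc, ← mul_assoc (u ^ a), h2]; simp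
    calc _ = Polynomial.aeval u s * u ^ a * (1 - Polynomial.aeval u t * Polynomial.aeval u q) := by
            rw [← h1]; simp
      _ = _ := by rw [mul_sub, h3]; simp
  rcases h _ hid with h0 | h0
  · right
    refine ⟨a, ?_⟩
    rw [h0, zero_add] at h1
    have h4 := congrArg (fun x => u ^ a * x) h1
    simp only [mul_one] at h4
    rw [hcomm t q, ← mul_assoc, h2, zero_mul] at h4
    exact h4.symm
  · left
    by_cases ha : a = 0
    · rw [ha, pow_zero, one_mul] at h2
      have : Polynomial.X * q.divX + Polynomial.C (q.coeff 0) = q := Polynomial.X_mul_divX_add q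
      have hc : q.coeff 0 ≠ 0 := by
        intro hc; apply hnd; exact Polynomial.X_dvd_iff.2 hc
      have h5 : u * Polynomial.aeval u q.divX = - algebraMap k A (q.coeff 0) := by
        rw [← this] at h2
        simp only [map_add, map_mul, Polynomial.aeval_X, Polynomial.aeval_C] at h2
        exact eq_neg_of_add_eq_zero_left h2
      have h6 : Polynomial.aeval u q.divX * u = - algebraMap k A (q.coeff 0) := by
        rw [← h5]
        have := hcomm q.divX Polynomial.X
        simpa using this
      have hiu : IsUnit (- algebraMap k A (q.coeff 0)) :=
        ((IsUnit.mk0 _ hc).map (algebraMap k A)).neg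
      have hc1 : Commute u (Polynomial.aeval u q.divX) := h5.trans h6.symm
      exact ((hc1.isUnit_mul_iff).1 (h5 ▸ hiu)).1
    · obtain ⟨b, rfl⟩ : ∃ b, a = b + 1 := ⟨a - 1, by omega⟩
      rw [pow_succ, ← mul_assoc] at h0
      have h7 : u * (Polynomial.aeval u s * u ^ b) = 1 := by
        rw [← h0]
        have := hcomm Polynomial.X (s * Polynomial.X ^ b)
        simpa using this
      exact ⟨⟨u, _, h7, h0⟩, rfl⟩

section KS
variable {T : Type u} [Category.{v} T] [HasZeroObject T] [Preadditive T] [HasShift T ℤ]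
    [∀ n : ℤ, (shiftFunctor T n).Additive] [Pretriangulated T]

theorem isIso_of_isUnit_end {X : T} (u : X ⟶ X) (h : IsUnit (M := End X) u) : IsIso u := by
  obtain ⟨w, hw⟩ := h
  exact ⟨(w⁻¹ : (End X)ˣ).1, by rw [← hw]; exact w.inv_mul, by rw [← hw]; exact w.mul_inv⟩

theorem indec_iso_or (k : Type*) [Field k] [CategoryTheory.Linear k T]
    [∀ X Y : T, FiniteDimensional k (X ⟶ Y)] {X : T} (hX : IsIndecomposable X) (u w : X ⟶ X) (h : IsIso (u + w)) :
    IsIso u ∨ IsIso w := by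
  haveI : FiniteDimensional k (End X) := inferInstanceAs (FiniteDimensional k (X ⟶ X))
  have key := unit_or_nil (k := k) (A := End X) (fun e he => hX.2 e he) (u ≫ inv (u + w) : X ⟶ X)
  rcases key with hu | hu
  · left
    have := isIso_of_isUnit_end _ hu
    have h2 : u = (u ≫ inv (u + w)) ≫ (u + w) := by
      rw [Category.assoc, IsIso.inv_hom_id, Category.comp_id]
    rw [h2]; infer_instance
  · right
    have h1 : IsUnit (M := End X) (1 - End.of (u ≫ inv (u + w))) := hu.isUnit_one_sub
    have := isIso_of_isUnit_end _ h1
    have h2 : w = (𝟙 X - u ≫ inv (u + w)) ≫ (u + w) := by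
      rw [Preadditive.sub_comp, Category.assoc, IsIso.inv_hom_id, Category.comp_id, Category.id_comp,
        add_sub_cancel_left]
    have h3 : IsIso (𝟙 X - u ≫ inv (u + w)) := this
    rw [h2]; infer_instance

theorem indec_id_ne {X : T} (hX : IsIndecomposable X) : 𝟙 X ≠ 0 := fun h =>
  hX.1 ((IsZero.iff_id_eq_zero X).2 h)

theorem not_isIso_zero_of_indec {X : T} (hX : IsIndecomposable X) (h : IsIso (0 : X ⟶ X)) :
    False := by
  apply indec_id_ne hX
  rw [← IsIso.hom_inv_id (0 : X ⟶ X), zero_comp]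

theorem indec_iso_sum (k : Type*) [Field k] [CategoryTheory.Linear k T]
    [∀ X Y : T, FiniteDimensional k (X ⟶ Y)] {X : T} (hX : IsIndecomposable X) {ι : Type*} (s : Finset ι)
    (u : ι → (X ⟶ X)) (h : IsIso (∑ j ∈ s, u j)) : ∃ j ∈ s, IsIso (u j) := by
  classical
  induction s using Finset.induction_on with
  | empty => rw [Finset.sum_empty] at h; exact (not_isIso_zero_of_indec hX h).elim
  | insert a s ha ih =>
    rw [Finset.sum_insert ha] at h
    rcases indec_iso_or k hX _ _ h with h | h
    · exact ⟨a, by simp, h⟩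
    · obtain ⟨j, hj, hj'⟩ := ih h
      exact ⟨j, by simp [hj], hj'⟩

/-- being a retract -/
abbrev IsRet (X Z : T) : Prop := ∃ (i : X ⟶ Z) (r : Z ⟶ X), i ≫ r = 𝟙 X

theorem IsRet.trans {X Y Z : T} (h : IsRet X Y) (h' : IsRet Y Z) : IsRet X Z := by
  obtain ⟨i, r, h⟩ := h
  obtain ⟨i', r', h'⟩ := h'
  exact ⟨i ≫ i', r' ≫ r, by simp [reassoc_of% h', h]⟩

theorem isRet_of_isIso {X Z : T} (i : X ⟶ Z) (r : Z ⟶ X) (h : IsIso (i ≫ r)) : IsRet X Z :=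
  ⟨i, r ≫ inv (i ≫ r), by rw [← Category.assoc, IsIso.hom_inv_id]⟩

theorem IsRet.iso {X Z : T} (hX : IsIndecomposable X) (hZ : IsIndecomposable Z) (h : IsRet X Z) :
    Nonempty (X ≅ Z) := by
  obtain ⟨i, r, h⟩ := h
  rcases hZ.2 (r ≫ i) (by simp [reassoc_of% h]) with h0 | h1
  · exfalso
    apply indec_id_ne hX
    have : 𝟙 X = i ≫ (r ≫ i) ≫ r := by simp [h]
    rw [this, h0]; simp
  · exact ⟨⟨i, r, h, h1⟩⟩

theorem isRet_biproduct (k : Type*) [Field k] [CategoryTheory.Linear k T]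
    [∀ X Y : T, FiniteDimensional k (X ⟶ Y)] {X : T} (hX : IsIndecomposable X) {n : ℕ} (F : Fin n → T)
    (h : IsRet X (⨁ F)) : ∃ j, IsRet X (F j) := by
  obtain ⟨i, r, h⟩ := h
  have h1 : 𝟙 X = ∑ j : Fin n, (i ≫ biproduct.π F j) ≫ (biproduct.ι F j ≫ r) := by
    rw [← h]
    conv_lhs => rw [← Category.id_comp r, ← biproduct.total (f := F)]
    rw [Preadditive.sum_comp, Preadditive.comp_sum]
    simp only [Category.assoc]
  obtain ⟨j, -, hj⟩ := indec_iso_sum k hX Finset.univ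
    (fun j => (i ≫ biproduct.π F j) ≫ (biproduct.ι F j ≫ r)) (by rw [← h1]; infer_instance)
  exact ⟨j, isRet_of_isIso _ _ hj⟩

theorem ks_induct (k : Type*) [Field k] [CategoryTheory.Linear k T]
    [∀ X Y : T, FiniteDimensional k (X ⟶ Y)] [IsIdempotentComplete T] (P : T → Prop) (hz : ∀ X, IsZero X → P X)
    (hi : ∀ X, IsIndecomposable X → P X)
    (hs : ∀ (X A B : T) (i : A ⟶ X) (p : X ⟶ A) (j : B ⟶ X) (q : X ⟶ B), i ≫ p = 𝟙 A →
      j ≫ q = 𝟙 B → i ≫ q = 0 → j ≫ p = 0 → p ≫ i + q ≫ j = 𝟙 X → P A → P B → P X) :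
    ∀ X, P X := by
  have main : ∀ n : ℕ, ∀ X : T, Module.finrank k (X ⟶ X) = n → P X := by
    intro n
    induction n using Nat.strong_induction_on with
    | _ n ih =>
      intro X hX
      by_cases h0 : IsZero X
      · exact hz X h0
      by_cases h1 : IsIndecomposable X
      · exact hi X h1
      have : ∃ e : X ⟶ X, e ≫ e = e ∧ e ≠ 0 ∧ e ≠ 𝟙 X := by
        by_contra hcon
        push Not at hcon
        exact h1 ⟨h0, fun e he => by
          by_cases h : e = 0
          · exact Or.inl h
          · exact Or.inr (hcon e he h)⟩
      obtain ⟨e, he, he0, he1⟩ := this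
      obtain ⟨A, i, p, hip, hpi⟩ := IsIdempotentComplete.idempotents_split X e he
      obtain ⟨B, j, q, hjq, hqj⟩ := IsIdempotentComplete.idempotents_split X (𝟙 X - e)
        (by simp [Preadditive.sub_comp, Preadditive.comp_sub, he])
      have hiq : i ≫ q = 0 := by
        have : i ≫ q = (i ≫ p ≫ i) ≫ (q ≫ j ≫ q) := by rw [hjq, reassoc_of% hip]; simp
        rw [this]
        have : (i ≫ p ≫ i) ≫ (q ≫ j ≫ q) = i ≫ ((p ≫ i) ≫ (q ≫ j)) ≫ q := by simp
        rw [this, hpi, hqj]; simp [Preadditive.comp_sub, he]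
      have hjp : j ≫ p = 0 := by
        have : j ≫ p = (j ≫ q ≫ j) ≫ (p ≫ i ≫ p) := by rw [hip, reassoc_of% hjq]; simp
        rw [this]
        have : (j ≫ q ≫ j) ≫ (p ≫ i ≫ p) = j ≫ ((q ≫ j) ≫ (p ≫ i)) ≫ p := by simp
        rw [this, hpi, hqj]; simp [Preadditive.sub_comp, he]
      have htot : p ≫ i + q ≫ j = 𝟙 X := by rw [hpi, hqj]; simp
      let φ : ((A ⟶ A) × (B ⟶ B)) →ₗ[k] (X ⟶ X) :=
        { toFun := fun ab => p ≫ ab.1 ≫ i + q ≫ ab.2 ≫ j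
          map_add' := by intro x y; simp; abel
          map_smul' := by intro c x; simp }
      have hφ : Function.Injective φ := by
        rw [injective_iff_map_eq_zero]
        rintro ⟨a, b⟩ hab
        change p ≫ a ≫ i + q ≫ b ≫ j = 0 at hab
        have ha : i ≫ (p ≫ a ≫ i + q ≫ b ≫ j) ≫ p = a := by
          simp [reassoc_of% hip, reassoc_of% hiq, hip, hjp]
        have hb : j ≫ (p ≫ a ≫ i + q ≫ b ≫ j) ≫ q = b := by
          simp [reassoc_of% hjq, reassoc_of% hjp, hjq, hiq]
        rw [hab] at ha hb
        simp at ha hb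
        rw [← ha, ← hb]; rfl
      have hle := LinearMap.finrank_le_finrank_of_injective hφ
      rw [Module.finrank_prod, hX] at hle
      have posA : 0 < Module.finrank k (A ⟶ A) := by
        haveI : Nontrivial (A ⟶ A) := ⟨𝟙 A, 0, fun h => he0 (by
          rw [← hpi, ← Category.id_comp i, h]; simp)⟩
        exact Module.finrank_pos
      have posB : 0 < Module.finrank k (B ⟶ B) := by
        haveI : Nontrivial (B ⟶ B) := ⟨𝟙 B, 0, fun h => he1 (by
          have : q ≫ j = 0 := by rw [← Category.id_comp j, h]; simp
          rw [hqj] at this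
          exact (sub_eq_zero.1 this).symm)⟩
        exact Module.finrank_pos
      exact hs X A B i p j q hip hjq hiq hjp htot (ih _ (by omega) A rfl) (ih _ (by omega) B rfl)
  exact fun X => main _ X rfl

theorem finite_indec_ret (k : Type*) [Field k] [CategoryTheory.Linear k T]
    [∀ X Y : T, FiniteDimensional k (X ⟶ Y)] [IsIdempotentComplete T] (Z : T) :
    {S : _root_.Quotient (CategoryTheory.isIsomorphicSetoid T) |
    ∃ X : T, IsIndecomposable X ∧ IsRet X Z ∧ isoClass X = S}.Finite := by
  revert Z
  apply ks_induct k
  · intro Z hZ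
    convert Set.finite_empty
    ext S
    simp only [Set.mem_ofPred_eq, Set.mem_empty_iff_false, iff_false]
    rintro ⟨X, hX, ⟨i, r, h⟩, -⟩
    apply indec_id_ne hX
    rw [← h, hZ.eq_of_tgt i 0, zero_comp]
  · intro Z hZ
    apply (Set.finite_singleton (isoClass Z)).subset
    rintro S ⟨X, hX, hr, rfl⟩
    obtain ⟨e⟩ := hr.iso hX hZ
    exact Quotient.sound ⟨e⟩
  · intro Z A B i p j q hip hjq hiq hjp htot hA hB
    apply (hA.union hB).subset
    rintro S ⟨X, hX, ⟨i', r', h'⟩, rfl⟩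
    have : IsIso ((i' ≫ p) ≫ (i ≫ r') + (i' ≫ q) ≫ (j ≫ r')) := by
      have : (i' ≫ p) ≫ (i ≫ r') + (i' ≫ q) ≫ (j ≫ r') = i' ≫ (p ≫ i + q ≫ j) ≫ r' := by
        simp
      rw [this, htot, Category.id_comp, h']; infer_instance
    rcases indec_iso_or k hX _ _ this with h | h
    · exact Or.inl ⟨X, hX, isRet_of_isIso _ _ h, rfl⟩
    · exact Or.inr ⟨X, hX, isRet_of_isIso _ _ h, rfl⟩

end KS

open scoped ZeroObject
set_option linter.unusedSectionVars false
set_option linter.style.haveILetI false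
set_option linter.unusedSimpArgs false

section Van
variable {T : Type u} [Category.{v} T] [HasZeroObject T] [Preadditive T] [HasShift T ℤ]
    [∀ n : ℤ, (shiftFunctor T n).Additive] [Pretriangulated T]

/-- vanishing of a Hom group -/
abbrev HV (X Y : T) : Prop := ∀ f : X ⟶ Y, f = 0

theorem HV.of_iso {X Y X' Y' : T} (h : HV X Y) (a : X ≅ X') (b : Y ≅ Y') : HV X' Y' := by
  intro f
  have : f = a.inv ≫ (a.hom ≫ f ≫ b.inv) ≫ b.hom := by simp
  rw [this, h (a.hom ≫ f ≫ b.inv)]; simp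

theorem HV.shift {X Y : T} (h : HV X Y) (n : ℤ) : HV (X⟦n⟧) (Y⟦n⟧) := by
  intro f
  obtain ⟨g, rfl⟩ := (shiftFunctor T n).map_surjective f
  rw [h g]; simp

theorem HV.unshift {X Y : T} (n : ℤ) (h : HV (X⟦n⟧) (Y⟦n⟧)) : HV X Y := by
  intro f
  apply (shiftFunctor T n).map_injective
  rw [h ((shiftFunctor T n).map f)]; simp

theorem isZero_of_hv {m : ℕ} {T₀ : T} (hT : IsPeriodicTilting m T₀) (C : T)
    (h : ∀ j : ℤ, HV C (T₀⟦j⟧)) : IsZero C := by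
  have key : ∀ X : T, ∀ j : ℤ, HV (C⟦j⟧) X := by
    apply hT.2 (fun Z => ∀ j : ℤ, HV (C⟦j⟧) Z)
    · refine ⟨?_, ?_, ?_, ?_⟩
      · rintro X Y ⟨e⟩ hX j
        exact (hX j).of_iso (Iso.refl _) e
      · intro X n hX j
        exact ((hX (j - n)).shift n).of_iso
          ((shiftFunctorAdd' T (j - n) n j (by omega)).app C).symm (Iso.refl _)
      · intro Tr hTr h1 h2 j f
        have h3 : f ≫ Tr.mor₃ = 0 :=
          (((h1 (j - 1)).shift 1).of_iso
            ((shiftFunctorAdd' T (j - 1) 1 j (by omega)).app C).symm (Iso.refl _)) _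
        obtain ⟨g, hg⟩ := Triangle.coyoneda_exact₃ Tr hTr f h3
        rw [hg, h2 j g, zero_comp]
      · intro X Z i r hir hZ j f
        rw [← Category.comp_id f, ← hir, ← Category.assoc, hZ j (f ≫ i), zero_comp]
    · intro j
      exact ((h (-j)).shift j).of_iso (Iso.refl _)
        ((shiftFunctorCompIsoId T (-j) j (by omega)).app T₀)
  rw [IsZero.iff_id_eq_zero]
  exact (HV.unshift 0 (key (C⟦(0 : ℤ)⟧) 0)) _

/-- Shifting by a multiple of the period. -/
def perIso {m : ℕ} (e : shiftFunctor T (m : ℤ) ≅ 𝟭 T) (X : T) (j : ℤ) :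
    X⟦j + m⟧ ≅ X⟦j⟧ :=
  (shiftFunctorAdd T j (m : ℤ)).app X ≪≫ e.app _

theorem hv_all {m : ℕ} (hm : 0 < m) (e : shiftFunctor T (m : ℤ) ≅ 𝟭 T) (C T₀ : T)
    (h : ∀ j : ℕ, 1 ≤ j → j ≤ m → HV C (T₀⟦(j : ℤ)⟧)) (j : ℤ) : HV C (T₀⟦j⟧) := by
  have hper : Function.Periodic (fun j : ℤ => HV C (T₀⟦j⟧)) (m : ℤ) := by
    intro j
    apply propext
    exact ⟨fun h => h.of_iso (Iso.refl _) (perIso e _ _),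
      fun h => h.of_iso (Iso.refl _) (perIso e _ _).symm⟩
  have h2 := hper.sub_zsmul_eq (x := j) ((j - 1) / m)
  have h3 : (1 : ℤ) ≤ j - ((j - 1) / m) • (m : ℤ) ∧ j - ((j - 1) / m) • (m : ℤ) ≤ m := by
    have hm' : (0 : ℤ) < m := by exact_mod_cast hm
    have h4 := Int.emod_nonneg (j - 1) hm'.ne'
    have h5 := Int.emod_lt_of_pos (j - 1) hm'
    have h6 := Int.mul_ediv_add_emod (j - 1) m
    rw [smul_eq_mul, mul_comm]
    constructor <;> linarith
  obtain ⟨n, hn⟩ := Int.eq_ofNat_of_zero_le (a := j - ((j - 1) / m) • (m : ℤ)) (by omega)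
  rw [hn] at h2 h3
  exact h2.mp (h n (by omega) (by omega))

theorem step {Y T' C T₀ : T} {f : Y ⟶ T'} {g : T' ⟶ C} {h : C ⟶ Y⟦(1 : ℤ)⟧}
    (hTr : Triangle.mk f g h ∈ distTriang T) (hf : ∀ a : Y ⟶ T₀, ∃ c, a = f ≫ c)
    (j : ℕ) (hj : 1 ≤ j) (hY : ∀ l : ℕ, 1 ≤ l → l < j → HV Y (T₀⟦(l : ℤ)⟧))
    (a : C ⟶ T₀⟦(j : ℤ)⟧) (ha : g ≫ a = 0) : a = 0 := by
  obtain ⟨b, hb⟩ : ∃ b : Y⟦(1 : ℤ)⟧ ⟶ T₀⟦(j : ℤ)⟧, a = h ≫ b :=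
    Triangle.yoneda_exact₃ _ hTr a ha
  let σ : T₀⟦(j : ℤ)⟧ ≅ T₀⟦((j - 1 : ℕ) : ℤ)⟧⟦(1 : ℤ)⟧ :=
    (shiftFunctorAdd' T ((j - 1 : ℕ) : ℤ) 1 j (by omega)).app T₀
  obtain ⟨b', hb'⟩ := (shiftFunctor T (1 : ℤ)).map_surjective (b ≫ σ.hom)
  have h1 : ∃ c, b' = f ≫ c := by
    by_cases hj1 : j = 1
    · subst hj1
      let τ : T₀⟦((1 - 1 : ℕ) : ℤ)⟧ ≅ T₀ := (shiftFunctorZero' T _ (by simp)).app T₀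
      obtain ⟨c, hc⟩ := hf (b' ≫ τ.hom)
      exact ⟨c ≫ τ.inv, by rw [← Category.assoc, ← hc]; simp⟩
    · exact ⟨0, by rw [hY (j - 1) (by omega) (by omega) b']; simp⟩
  obtain ⟨c, rfl⟩ := h1
  have h2 : h ≫ f⟦(1 : ℤ)⟧' = 0 := comp_distTriang_mor_zero₃₁ _ hTr
  rw [← cancel_mono σ.hom, hb, Category.assoc, ← hb', Functor.map_comp, reassoc_of% h2]
  simp

theorem exists_surj (T₀ : T) (M : Type*) [AddCommGroup M] [Module (End T₀) M]
    [Module.Finite (End T₀) M] : ∃ (n : ℕ)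
      (p : ((⨁ fun _ : Fin n => T₀) ⟶ T₀) →ₗ[End T₀] M), Function.Surjective p := by
  obtain ⟨n, s, hs⟩ := Module.Finite.exists_fin (R := End T₀) (M := M)
  let p : ((⨁ fun _ : Fin n => T₀) ⟶ T₀) →ₗ[End T₀] M :=
    { toFun := fun g => ∑ j, (End.of (biproduct.ι (fun _ : Fin n => T₀) j ≫ g)) • s j
      map_add' := by
        intro x y
        rw [← Finset.sum_add_distrib]
        refine Finset.sum_congr rfl fun j _ => ?_
        rw [← add_smul]
        congr 1
        exact Preadditive.comp_add _ _ _ _ _ _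
      map_smul' := by
        intro c x
        rw [RingHom.id_apply, Finset.smul_sum]
        refine Finset.sum_congr rfl fun j _ => ?_
        rw [← mul_smul]
        congr 1
        exact (Category.assoc _ _ _).symm }
  refine ⟨n, p, ?_⟩
  rw [← LinearMap.range_eq_top, ← top_le_iff, ← hs, Submodule.span_le]
  rintro _ ⟨j, rfl⟩
  refine ⟨biproduct.π (fun _ : Fin n => T₀) j, ?_⟩
  change ∑ l, (End.of (biproduct.ι (fun _ : Fin n => T₀) l ≫ biproduct.π _ j)) • s l = s j
  rw [Finset.sum_eq_single j]
  · rw [biproduct.ι_π_self]; exact one_smul _ _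
  · intro l _ hl
    rw [biproduct.ι_π_ne _ hl]; exact zero_smul _ _
  · simp

theorem lin_repr {T₀ Y : T} {n : ℕ}
    (p : ((⨁ fun _ : Fin n => T₀) ⟶ T₀) →ₗ[End T₀] (Y ⟶ T₀)) :
    ∃ y : Y ⟶ (⨁ fun _ : Fin n => T₀), ∀ g, p g = y ≫ g := by
  refine ⟨biproduct.lift fun j => p (biproduct.π _ j), fun g => ?_⟩
  have h1 : g = ∑ j, End.of (biproduct.ι (fun _ : Fin n => T₀) j ≫ g) •
      biproduct.π (fun _ : Fin n => T₀) j := by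
    conv_lhs => rw [← Category.id_comp g, ← biproduct.total, Preadditive.sum_comp]
    simp only [Category.assoc]
    rfl
  conv_lhs => rw [h1]
  rw [map_sum]
  simp only [map_smul]
  have h2 : ∀ j, End.of (biproduct.ι (fun _ : Fin n => T₀) j ≫ g) • p (biproduct.π _ j) =
    p (biproduct.π _ j) ≫ biproduct.ι (fun _ : Fin n => T₀) j ≫ g := fun j => rfl
  simp only [h2]
  rw [biproduct.lift_eq, Preadditive.sum_comp]
  simp

theorem proj_repr [IsIdempotentComplete T] (T₀ : T) (M : Type*) [AddCommGroup M]
    [Module (End T₀) M] [Module.Finite (End T₀) M] [Module.Projective (End T₀) M] :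
    ∃ (n : ℕ) (T' : T) (_ : IsRet T' (⨁ fun _ : Fin n => T₀)),
      Nonempty ((T' ⟶ T₀) ≃ₗ[End T₀] M) := by
  obtain ⟨n, p, hp⟩ := exists_surj T₀ M
  obtain ⟨s, hs⟩ := Module.projective_lifting_property p LinearMap.id hp
  have hs' : ∀ x, p (s x) = x := fun x => LinearMap.congr_fun hs x
  obtain ⟨y, hy⟩ := lin_repr (s.comp p)
  have hy' : ∀ g, s (p g) = y ≫ g := hy
  have hyy : y ≫ y = y := by
    apply biproduct.hom_ext
    intro j
    rw [Category.assoc, ← hy', ← hy', hs']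
  obtain ⟨T', i, r, hir, hri⟩ := IsIdempotentComplete.idempotents_split _ y hyy
  refine ⟨n, T', ⟨i, r, hir⟩, ⟨?_⟩⟩
  let R : (T' ⟶ T₀) →ₗ[End T₀] ((⨁ fun _ : Fin n => T₀) ⟶ T₀) :=
    { toFun := fun g => r ≫ g
      map_add' := fun x z => Preadditive.comp_add _ _ _ _ _ _
      map_smul' := fun c x => (Category.assoc _ _ _).symm }
  let I : ((⨁ fun _ : Fin n => T₀) ⟶ T₀) →ₗ[End T₀] (T' ⟶ T₀) :=
    { toFun := fun g => i ≫ g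
      map_add' := fun x z => Preadditive.comp_add _ _ _ _ _ _
      map_smul' := fun c x => (Category.assoc _ _ _).symm }
  refine LinearEquiv.ofLinearMap (p.comp R) (I.comp s) ?_ ?_
  · ext x
    change p (r ≫ i ≫ s x) = x
    rw [← Category.assoc, hri, ← hy', hs', hs']
  · ext g
    change i ≫ s (p (r ≫ g)) = g
    rw [hy', ← hri]
    simp [reassoc_of% hir]

/-- Precomposition -/
def pre {X Y : T} (T₀ : T) (f : X ⟶ Y) : (Y ⟶ T₀) →ₗ[End T₀] (X ⟶ T₀) where
  toFun g := f ≫ g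
  map_add' _ _ := Preadditive.comp_add _ _ _ _ _ _
  map_smul' _ _ := (Category.assoc _ _ _).symm

theorem pre_apply {X Y : T} (T₀ : T) (f : X ⟶ Y) (g : Y ⟶ T₀) : pre T₀ f g = f ≫ g := rfl

theorem isScalarTower_end (k : Type*) [Field k] [CategoryTheory.Linear k T] (Y T₀ : T) :
    IsScalarTower k (End T₀) (Y ⟶ T₀) :=
  ⟨fun x y z => by
    change z ≫ (x • (y : T₀ ⟶ T₀)) = x • (z ≫ (y : T₀ ⟶ T₀))
    exact Linear.comp_smul _ _ _ _ _ _⟩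

theorem finite_hom (k : Type*) [Field k] [CategoryTheory.Linear k T]
    [∀ X Y : T, FiniteDimensional k (X ⟶ Y)] (Y T₀ : T) : Module.Finite (End T₀) (Y ⟶ T₀) :=
  haveI := isScalarTower_end k Y T₀
  Module.Finite.of_restrictScalars_finite k _ _

variable (T) in
/-- Relations of the Grothendieck group. -/
noncomputable def K2rel : Submodule (ZMod 2) (T →₀ ZMod 2) :=
  Submodule.span _ {x | ∃ Tr : Triangle T, Tr ∈ distTriang T ∧
    x = Finsupp.single Tr.obj₁ 1 + Finsupp.single Tr.obj₂ 1 + Finsupp.single Tr.obj₃ 1}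

variable (T) in
/-- The Grothendieck group mod 2 -/
abbrev K2 := (T →₀ ZMod 2) ⧸ K2rel T

/-- the class of an object -/
noncomputable def cls (X : T) : K2 T := (K2rel T).mkQ (Finsupp.single X 1)

theorem cls_tri (Tr : Triangle T) (h : Tr ∈ distTriang T) :
    cls Tr.obj₁ + cls Tr.obj₂ + cls Tr.obj₃ = 0 := by
  unfold cls
  rw [← map_add, ← map_add, Submodule.mkQ_apply, Submodule.Quotient.mk_eq_zero]
  exact Submodule.subset_span ⟨Tr, h, rfl⟩

theorem two_K2 (x : K2 T) : x + x = 0 := by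
  rw [← two_smul (ZMod 2) x]
  have : (2 : ZMod 2) = 0 := by decide
  rw [this, zero_smul]

theorem cls_tri_one (Tr : Triangle T) (h : Tr ∈ distTriang T) :
    cls Tr.obj₁ = cls Tr.obj₂ + cls Tr.obj₃ := by
  have h1 := cls_tri Tr h
  have h2 := two_K2 (cls Tr.obj₁)
  rw [add_assoc] at h1
  rw [← h2] at h1
  exact (add_left_cancel h1).symm

theorem cls_mk {X Y Z : T} {f : X ⟶ Y} {g : Y ⟶ Z} {h : Z ⟶ X⟦(1 : ℤ)⟧}
    (hTr : Triangle.mk f g h ∈ distTriang T) : cls X = cls Y + cls Z :=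
  cls_tri_one _ hTr

theorem cls_zero' : cls (0 : T) = 0 := by
  have h1 : cls (0 : T) = cls (0 : T) + cls (0 : T) :=
    cls_tri_one _ (contractible_distinguished (0 : T))
  rw [h1, two_K2]

theorem cls_iso {X Y : T} (e : X ≅ Y) : cls X = cls Y := by
  have h0 : cls X = cls X + cls (0 : T) := by rw [cls_zero', add_zero]
  have h1 : cls X = cls Y + cls (0 : T) := cls_mk (f := e.hom) (g := (0 : Y ⟶ (0 : T))) (h := 0)
    (isomorphic_distinguished _ (contractible_distinguished X) _
      (Triangle.isoMk _ (contractibleTriangle X) (Iso.refl X) e.symm (Iso.refl (0 : T))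
        (by change e.hom ≫ e.inv = 𝟙 X ≫ 𝟙 X; simp)
        ((isZero_zero T).eq_of_tgt _ _) ((isZero_zero T).eq_of_src _ _)))
  rw [h1, cls_zero', add_zero]

theorem cls_zero (X : T) (h : IsZero X) : cls X = 0 := by
  rw [cls_iso (h.iso (isZero_zero T)), cls_zero']

theorem proj_bip (T₀ : T) (N : ℕ) :
    Module.Projective (End T₀) ((⨁ fun _ : Fin N => T₀) ⟶ T₀) := by
  let E : (Fin N → End T₀) ≃ₗ[End T₀] ((⨁ fun _ : Fin N => T₀) ⟶ T₀) :=
    { toFun := fun a => biproduct.desc (fun j => (a j : T₀ ⟶ T₀))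
      map_add' := by
        intro x y
        apply biproduct.hom_ext'
        intro j
        rw [Preadditive.comp_add]
        simp only [biproduct.ι_desc]
        rfl
      map_smul' := by
        intro c x
        apply biproduct.hom_ext'
        intro j
        have : (RingHom.id (End T₀)) c • biproduct.desc (fun j => (x j : T₀ ⟶ T₀)) =
          biproduct.desc (fun j => (x j : T₀ ⟶ T₀)) ≫ (c : T₀ ⟶ T₀) := rfl
        rw [this, biproduct.ι_desc_assoc, biproduct.ι_desc]
        rfl
      invFun := fun g j => End.of (biproduct.ι (fun _ : Fin N => T₀) j ≫ g)
      left_inv := by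
        intro x
        funext j
        exact biproduct.ι_desc _ _
      right_inv := by
        intro x
        apply biproduct.hom_ext'
        intro j
        exact biproduct.ι_desc _ _ }
  exact Module.Projective.of_equiv E

theorem hv_ret {m : ℕ} {T₀ : T} (hT : IsPeriodicTilting m T₀) (n : ℕ) (T' : T)
    (h : IsRet T' (⨁ fun _ : Fin n => T₀)) (l : ℕ) (h1 : 1 ≤ l) (h2 : l < m) :
    HV T' (T₀⟦(l : ℤ)⟧) := by
  intro f
  obtain ⟨i, r, hir⟩ := h
  have : r ≫ f = 0 := by
    apply biproduct.hom_ext'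
    intro j
    rw [hT.1 l (by
      intro hd
      have := Int.le_of_dvd (by omega) hd
      omega) (biproduct.ι (fun _ : Fin n => T₀) j ≫ r ≫ f), comp_zero]
  rw [← Category.id_comp f, ← hir, Category.assoc, this, comp_zero]

theorem span_conc (k : Type*) [Field k] [CategoryTheory.Linear k T]
    [∀ X Y : T, FiniteDimensional k (X ⟶ Y)] [IsIdempotentComplete T]
    {m : ℕ} (hm : 0 < m) (e : shiftFunctor T (m : ℤ) ≅ 𝟭 T) {T₀ : T}
    (hT : IsPeriodicTilting m T₀) (W : Submodule (ZMod 2) (K2 T))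
    (hW : ∀ (n : ℕ) (T' : T), IsRet T' (⨁ fun _ : Fin n => T₀) → cls T' ∈ W) :
    ∀ n : ℕ, n < m → ∀ Y : T, (∀ l : ℕ, 1 ≤ l → l < m → HV Y (T₀⟦(l : ℤ)⟧)) →
      HasProjectiveDimensionLT (ModuleCat.of.{v} (End T₀) (Y ⟶ T₀)) (n + 1) → cls Y ∈ W := by
  intro n
  induction n with
  | zero =>
    intro _ Y hY hpd
    haveI := finite_hom k Y T₀
    haveI : Projective (ModuleCat.of.{v} (End T₀) (Y ⟶ T₀)) :=
      projective_iff_hasProjectiveDimensionLT_one.2 hpd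
    haveI : Module.Projective (End T₀) (Y ⟶ T₀) :=
      (IsProjective.iff_projective (R := End T₀) (Y ⟶ T₀)).2 this
    obtain ⟨n, T', hr, ⟨θ⟩⟩ := proj_repr T₀ (Y ⟶ T₀)
    obtain ⟨i, r, hir⟩ := id hr
    obtain ⟨y, hy⟩ := lin_repr (θ.toLinearMap.comp (pre T₀ i))
    have ht : ∀ g : T' ⟶ T₀, θ g = (y ≫ r) ≫ g := by
      intro g
      have := hy (r ≫ g)
      rw [LinearMap.comp_apply, pre_apply, reassoc_of% hir] at this
      rw [Category.assoc]; exact this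
    obtain ⟨C, g, h, hTr⟩ := distinguished_cocone_triangle (y ≫ r)
    have hf : ∀ a : Y ⟶ T₀, ∃ c, a = (y ≫ r) ≫ c := fun a =>
      ⟨θ.symm a, by rw [← ht]; simp⟩
    have hC : IsZero C := by
      apply isZero_of_hv hT
      apply hv_all hm e
      intro j h1 h2 a
      apply step hTr hf j h1 (fun l h3 h4 => hY l h3 (by omega)) a
      by_cases hjm : j = m
      · subst hjm
        rw [← cancel_mono ((e.app T₀).hom), zero_comp]
        apply θ.injective
        rw [map_zero, ht]
        have : (y ≫ r) ≫ g = 0 := comp_distTriang_mor_zero₁₂ _ hTr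
        rw [← Category.assoc, ← Category.assoc (y ≫ r), this]
        simp
      · exact hv_ret hT n T' hr j h1 (by omega) _
    rw [cls_mk hTr]
    exact W.add_mem (hW n T' hr) (by
      change cls C ∈ W
      rw [cls_zero C hC]; exact W.zero_mem)
  | succ n ih =>
    intro hn Y hY hpd
    haveI := finite_hom k Y T₀
    obtain ⟨N, p, hp⟩ := exists_surj T₀ (Y ⟶ T₀)
    obtain ⟨y, hy⟩ := lin_repr p
    obtain ⟨C, g, h, hTr⟩ := distinguished_cocone_triangle y
    have hf : ∀ a : Y ⟶ T₀, ∃ c, a = y ≫ c := fun a => by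
      obtain ⟨c, hc⟩ := hp a
      exact ⟨c, by rw [← hy, hc]⟩
    have hr : IsRet (⨁ fun _ : Fin N => T₀) (⨁ fun _ : Fin N => T₀) := ⟨𝟙 _, 𝟙 _, by simp⟩
    rw [cls_mk hTr]
    refine W.add_mem (hW N _ hr) ?_
    change cls C ∈ W
    apply ih (by omega)
    · intro l h1 h2 a
      exact step hTr hf l h1 (fun l h3 h4 => hY l h3 (by omega)) a (hv_ret hT N _ hr l h1 h2 _)
    · let S : ShortComplex (ModuleCat.{v} (End T₀)) :=
        ShortComplex.mk (ModuleCat.ofHom (pre T₀ g)) (ModuleCat.ofHom (pre T₀ y)) (by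
          ext a
          have : y ≫ g = 0 := comp_distTriang_mor_zero₁₂ _ hTr
          change y ≫ g ≫ a = 0
          rw [reassoc_of% this, zero_comp])
      have hS : S.ShortExact := by
        refine ShortComplex.ShortExact.mk' ?_ ?_ ?_
        · rw [ShortComplex.moduleCat_exact_iff]
          intro a ha
          obtain ⟨b, hb⟩ := Triangle.yoneda_exact₂ _ hTr a ha
          exact ⟨b, hb.symm⟩
        · rw [ModuleCat.mono_iff_injective]
          change Function.Injective (pre T₀ g)
          rw [injective_iff_map_eq_zero]
          intro a ha
          change g ≫ a = 0 at ha
          have := step hTr hf m hm hY (a ≫ (e.app T₀).inv)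
            (by rw [← Category.assoc, ha, zero_comp])
          rw [← cancel_mono (e.app T₀).inv, this, zero_comp]
        · rw [ModuleCat.epi_iff_surjective]
          intro a
          obtain ⟨c, hc⟩ := hf a
          exact ⟨c, hc.symm⟩
      have hP : Projective S.X₂ := by
        apply (IsProjective.iff_projective (R := End T₀) _).1
        exact proj_bip T₀ N
      exact (hS.hasProjectiveDimensionLT_X₃_iff n hP).1 hpd

theorem span_all (k : Type*) [Field k] [CategoryTheory.Linear k T]
    [∀ X Y : T, FiniteDimensional k (X ⟶ Y)] [IsIdempotentComplete T]
    {m : ℕ} (hm : 0 < m) (e : shiftFunctor T (m : ℤ) ≅ 𝟭 T) {T₀ : T}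
    (hT : IsPeriodicTilting m T₀) (W : Submodule (ZMod 2) (K2 T))
    (hpd : ∀ M : ModuleCat.{v} (End T₀), HasProjectiveDimensionLT M m)
    (hW : ∀ (n : ℕ) (T' : T), IsRet T' (⨁ fun _ : Fin n => T₀) → cls T' ∈ W) (Y : T) :
    cls Y ∈ W := by
  have main : ∀ j : ℕ, ∀ Y : T, (∀ l : ℕ, 1 ≤ l → l + j < m → HV Y (T₀⟦(l : ℤ)⟧)) →
      cls Y ∈ W := by
    intro j
    induction j with
    | zero =>
      intro Y hY
      apply span_conc k hm e hT W hW (m - 1) (by omega) Y hY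
      rw [Nat.sub_add_cancel hm]
      exact hpd _
    | succ j ih =>
      intro Y hY
      haveI := finite_hom k Y T₀
      obtain ⟨N, p, hp⟩ := exists_surj T₀ (Y ⟶ T₀)
      obtain ⟨y, hy⟩ := lin_repr p
      obtain ⟨C, g, h, hTr⟩ := distinguished_cocone_triangle y
      have hf : ∀ a : Y ⟶ T₀, ∃ c, a = y ≫ c := fun a => by
        obtain ⟨c, hc⟩ := hp a
        exact ⟨c, by rw [← hy, hc]⟩
      have hr : IsRet (⨁ fun _ : Fin N => T₀) (⨁ fun _ : Fin N => T₀) := ⟨𝟙 _, 𝟙 _, by simp⟩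
      rw [cls_mk hTr]
      refine W.add_mem (hW N _ hr) (ih C ?_)
      intro l h1 h2 a
      refine step hTr hf l h1 (fun l h3 h4 => hY l h3 (by omega)) a ?_
      exact hv_ret hT N _ hr l (by omega) (by omega) _
  exact main m Y (by intro l h1 h2; omega)

end Van

open scoped ZeroObject
set_option linter.unusedSectionVars false
set_option linter.style.haveILetI false

section Corner
variable {T : Type u} [Category.{v} T] [HasZeroObject T] [Preadditive T] [HasShift T ℤ]
    [∀ n : ℤ, (shiftFunctor T n).Additive] [Pretriangulated T]

/-- retract data -/
structure RD (X T₀ : T) where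
  i : X ⟶ T₀
  r : T₀ ⟶ X
  h : i ≫ r = 𝟙 X

/-- the non-unital transport of endomorphisms -/
def RD.up {X T₀ : T} (d : RD X T₀) (f : End X) : End T₀ := End.of (d.r ≫ End.asHom f ≫ d.i)

theorem RD.up_mul {X T₀ : T} (d : RD X T₀) (f g : End X) : d.up (f * g) = d.up f * d.up g := by
  change d.r ≫ (g ≫ f) ≫ d.i = (d.r ≫ g ≫ d.i) ≫ (d.r ≫ f ≫ d.i)
  simp [reassoc_of% d.h]

theorem RD.up_add {X T₀ : T} (d : RD X T₀) (f g : End X) : d.up (f + g) = d.up f + d.up g := by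
  change d.r ≫ ((End.asHom f) + (End.asHom g)) ≫ d.i = (d.r ≫ (f : X ⟶ X) ≫ d.i) + (d.r ≫ (g : X ⟶ X) ≫ d.i)
  rw [Preadditive.add_comp (C := T), Preadditive.comp_add (C := T)]

theorem RD.up_zero {X T₀ : T} (d : RD X T₀) : d.up 0 = 0 := by
  change d.r ≫ (0 : X ⟶ X) ≫ d.i = 0
  simp

/-- the corner of a module -/
def Crn {X T₀ : T} (d : RD X T₀) (M : Type*) [AddCommGroup M] [Module (End T₀) M] : AddSubgroup M where
  carrier := {x | d.up 1 • x = x}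
  add_mem' := by
    intro a b ha hb
    change _ • _ = _ at ha hb ⊢
    rw [smul_add, ha, hb]
  zero_mem' := smul_zero _
  neg_mem' := by
    intro a ha
    change _ • _ = _ at ha ⊢
    rw [smul_neg, ha]

section
variable {X T₀ : T} (d : RD X T₀) {M N P : Type*} [AddCommGroup M] [Module (End T₀) M]
  [AddCommGroup N] [Module (End T₀) N] [AddCommGroup P] [Module (End T₀) P]

theorem mem_crn (x : M) : x ∈ Crn d M ↔ d.up 1 • x = x := Iff.rfl

theorem up_mem (f : End X) (x : M) : d.up f • x ∈ Crn d M := by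
  rw [mem_crn, smul_smul, ← d.up_mul, one_mul]

instance crnModule : Module (End X) (Crn d M) where
  smul f x := ⟨d.up f • (x : M), up_mem d f (x : M)⟩
  one_smul x := Subtype.ext x.2
  mul_smul f g x := Subtype.ext (by
    change d.up (f * g) • (x : M) = d.up f • d.up g • (x : M)
    rw [d.up_mul, mul_smul])
  smul_zero f := Subtype.ext (smul_zero (d.up f))
  smul_add f x y := Subtype.ext (smul_add (d.up f) (x : M) y)
  add_smul f g x := Subtype.ext (by
    change d.up (f + g) • (x : M) = d.up f • (x : M) + d.up g • (x : M)
    rw [d.up_add, add_smul])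
  zero_smul x := Subtype.ext (by
    change d.up 0 • (x : M) = 0
    rw [d.up_zero, zero_smul])

theorem crn_smul_coe (f : End X) (x : Crn d M) : ((f • x : Crn d M) : M) = d.up f • (x : M) := rfl

/-- functoriality -/
def crnMap (φ : M →ₗ[End T₀] N) : Crn d M →ₗ[End X] Crn d N where
  toFun x := ⟨φ x, by rw [mem_crn, ← map_smul, (mem_crn d _).1 x.2]⟩
  map_add' x y := Subtype.ext (map_add φ (x : M) y)
  map_smul' f x := Subtype.ext (map_smul φ (d.up f) (x : M))

theorem crnMap_coe (φ : M →ₗ[End T₀] N) (x : Crn d M) : (crnMap d φ x : N) = φ x := rfl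

theorem crnMap_inj (φ : M →ₗ[End T₀] N) (h : Function.Injective φ) :
    Function.Injective (crnMap d φ) := fun _ _ hxy =>
  Subtype.ext (h (congrArg Subtype.val hxy))

theorem crnMap_surj (φ : M →ₗ[End T₀] N) (h : Function.Surjective φ) :
    Function.Surjective (crnMap d φ) := by
  intro y
  obtain ⟨x, hx⟩ := h y
  refine ⟨⟨d.up 1 • x, up_mem d 1 x⟩, Subtype.ext ?_⟩
  change φ (d.up 1 • x) = y
  rw [map_smul, hx]; exact y.2

theorem crnMap_exact (φ : M →ₗ[End T₀] N) (ψ : N →ₗ[End T₀] P) (h : Function.Exact φ ψ) :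
    Function.Exact (crnMap d φ) (crnMap d ψ) := by
  intro y
  constructor
  · intro hy
    obtain ⟨x, hx⟩ := (h y).1 (congrArg Subtype.val hy)
    refine ⟨⟨d.up 1 • x, up_mem d 1 x⟩, Subtype.ext ?_⟩
    change φ (d.up 1 • x) = y
    rw [map_smul, hx]; exact y.2
  · rintro ⟨x, rfl⟩
    exact Subtype.ext ((h _).2 ⟨x, rfl⟩)

variable (M) in
/-- length of the corner -/
noncomputable def lenC : ℕ∞ := Module.length (End X) (Crn d M)

variable (M) in
/-- multiplicity mod 2 -/
noncomputable def mu : ZMod 2 := ((lenC d M).toNat : ZMod 2)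

theorem lenC_le_inj (φ : M →ₗ[End T₀] N) (h : Function.Injective φ) : lenC d M ≤ lenC d N :=
  Module.length_le_of_injective (crnMap d φ) (crnMap_inj d φ h)

theorem lenC_le_surj (φ : M →ₗ[End T₀] N) (h : Function.Surjective φ) : lenC d N ≤ lenC d M :=
  Module.length_le_of_surjective (crnMap d φ) (crnMap_surj d φ h)

theorem mu_equiv (φ : M ≃ₗ[End T₀] N) : mu d M = mu d N := by
  unfold mu
  rw [le_antisymm (lenC_le_inj d φ.toLinearMap φ.injective)
    (lenC_le_surj d φ.toLinearMap φ.surjective)]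

theorem mu_exact (φ : M →ₗ[End T₀] N) (ψ : N →ₗ[End T₀] P) (hi : Function.Injective φ)
    (hs : Function.Surjective ψ) (h : Function.Exact φ ψ) (hN : lenC d N ≠ ⊤) :
    mu d N = mu d M + mu d P := by
  have h1 := Module.length_eq_add_of_exact (crnMap d φ) (crnMap d ψ) (crnMap_inj d φ hi)
    (crnMap_surj d ψ hs) (crnMap_exact d φ ψ h)
  have h2 : lenC d N = lenC d M + lenC d P := h1
  have hM : lenC d M ≠ ⊤ := ne_top_of_le_ne_top hN (lenC_le_inj d φ hi)
  have hP : lenC d P ≠ ⊤ := ne_top_of_le_ne_top hN (lenC_le_surj d ψ hs)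
  unfold mu
  rw [h2, ENat.toNat_add hM hP]; push_cast; rfl

theorem mu_ker_range (φ : M →ₗ[End T₀] N) (hM : lenC d M ≠ ⊤) :
    mu d M = mu d (LinearMap.ker φ) + mu d (LinearMap.range φ) :=
  mu_exact d (LinearMap.ker φ).subtype φ.rangeRestrict (Submodule.injective_subtype _)
    φ.surjective_rangeRestrict (by
      rw [LinearMap.exact_iff, LinearMap.ker_rangeRestrict, Submodule.range_subtype]) hM

theorem mu_triv (h : ∀ x : M, x = 0) : mu d M = 0 := by
  haveI : Subsingleton (Crn d M) := ⟨fun a b => Subtype.ext ((h _).trans (h _).symm)⟩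
  unfold mu lenC
  rw [Module.length_eq_zero]; simp

end

theorem lenC_hom (k : Type*) [Field k] [CategoryTheory.Linear k T]
    [∀ X Y : T, FiniteDimensional k (X ⟶ Y)] {X T₀ : T} (d : RD X T₀) (Y : T) :
    lenC d (Y ⟶ T₀) ≠ ⊤ := by
  let φ : Crn d (Y ⟶ T₀) →ₗ[End X] (Y ⟶ X) :=
    { toFun := fun f => (f : Y ⟶ T₀) ≫ d.r
      map_add' := fun f g => Preadditive.add_comp _ _ _ _ _ _
      map_smul' := fun a f => by
        change ((f : Y ⟶ T₀) ≫ (d.r ≫ (a : X ⟶ X) ≫ d.i)) ≫ d.r = (f ≫ d.r) ≫ a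
        simp [d.h] }
  have hφ : Function.Injective φ := by
    intro f g hfg
    apply Subtype.ext
    have hf : (f : Y ⟶ T₀) ≫ (d.r ≫ 𝟙 X ≫ d.i) = f := f.2
    have hg : (g : Y ⟶ T₀) ≫ (d.r ≫ 𝟙 X ≫ d.i) = g := g.2
    have h : (f : Y ⟶ T₀) ≫ d.r = (g : Y ⟶ T₀) ≫ d.r := hfg
    rw [← hf, ← hg, reassoc_of% h]
  haveI := isScalarTower_end k Y X
  haveI : IsNoetherian (End X) (Y ⟶ X) := isNoetherian_of_tower k inferInstance
  haveI : IsArtinian (End X) (Y ⟶ X) := isArtinian_of_tower k inferInstance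
  refine ne_top_of_le_ne_top ?_ (Module.length_le_of_injective φ hφ)
  exact Module.length_ne_top

theorem lenC_fg (k : Type*) [Field k] [CategoryTheory.Linear k T]
    [∀ X Y : T, FiniteDimensional k (X ⟶ Y)] {X T₀ : T} (d : RD X T₀) (M : Type*)
    [AddCommGroup M] [Module (End T₀) M] [Module.Finite (End T₀) M] :
    lenC d M ≠ ⊤ := by
  obtain ⟨n, p, hp⟩ := exists_surj T₀ M
  exact ne_top_of_le_ne_top (lenC_hom k d _) (lenC_le_surj d p hp)

end Corner

open scoped ZeroObject

section Func
variable {T : Type u} [Category.{v} T] [HasZeroObject T] [Preadditive T] [HasShift T ℤ]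
    [∀ n : ℤ, (shiftFunctor T n).Additive] [Pretriangulated T]

/-- multiplicity of the kernel -/
noncomputable def kap {X T₀ : T} (d : RD X T₀) {U V : T} (f : U ⟶ V) : ZMod 2 :=
  mu d (LinearMap.ker (pre T₀ f))

theorem kap_le {X T₀ : T} (d : RD X T₀) {U V U' V' : T} (f : U ⟶ V) (f' : U' ⟶ V')
    (a : U ⟶ U') (b : V ⟶ V') [Epi b] (h : f ≫ b = a ≫ f') :
    lenC d (LinearMap.ker (pre T₀ f')) ≤ lenC d (LinearMap.ker (pre T₀ f)) := by
  have hmem : ∀ x ∈ LinearMap.ker (pre T₀ f'), pre T₀ b x ∈ LinearMap.ker (pre T₀ f) := by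
    intro x hx
    rw [LinearMap.mem_ker, pre_apply] at hx
    rw [LinearMap.mem_ker, pre_apply, pre_apply, reassoc_of% h, hx, comp_zero]
  apply lenC_le_inj d ((pre T₀ b).restrict hmem)
  intro x y hxy
  have h1 : b ≫ (x : V' ⟶ T₀) = b ≫ (y : V' ⟶ T₀) := congrArg Subtype.val hxy
  exact Subtype.ext ((cancel_epi b).1 h1)

theorem kap_iso {X T₀ : T} (d : RD X T₀) {U V U' V' : T} (f : U ⟶ V) (f' : U' ⟶ V')
    (a : U ≅ U') (b : V ≅ V') (h : f ≫ b.hom = a.hom ≫ f') : kap d f = kap d f' := by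
  unfold kap mu
  rw [le_antisymm (kap_le d f' f a.inv b.inv (by
    rw [Iso.eq_inv_comp, ← reassoc_of% h]; simp)) (kap_le d f f' a.hom b.hom h)]

theorem kap_units {X T₀ : T} (d : RD X T₀) {U V : T} (f : U ⟶ V) (u : ℤˣ) :
    kap d (u • f) = kap d f := by
  rcases Int.units_eq_one_or u with rfl | rfl
  · rw [one_smul]
  · have h : ((-1 : ℤˣ) • f) = - f := by
      rw [Units.smul_def]; simp
    rw [h]
    exact kap_iso d _ _ ⟨-𝟙 U, -𝟙 U, by simp, by simp⟩ (Iso.refl _) (by simp)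

theorem kap_neg {X T₀ : T} (d : RD X T₀) {U V : T} (f : U ⟶ V) :
    kap d (-f) = kap d f :=
  kap_iso d _ _ ⟨-𝟙 U, -𝟙 U, by simp, by simp⟩ (Iso.refl _) (by simp)

theorem mu_hom_iso {X T₀ : T} (d : RD X T₀) {U V : T} (a : U ≅ V) :
    mu d (U ⟶ T₀) = mu d (V ⟶ T₀) := by
  apply mu_equiv d (LinearEquiv.ofBijective (pre T₀ a.inv) ⟨?_, ?_⟩)
  · intro x y h
    exact (cancel_epi a.inv).1 h
  · intro y
    exact ⟨a.hom ≫ y, by simp [pre_apply]⟩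

theorem mu_tri (k : Type*) [Field k] [CategoryTheory.Linear k T]
    [∀ X Y : T, FiniteDimensional k (X ⟶ Y)] {X T₀ : T} (d : RD X T₀) (Tr : Triangle T)
    (h : Tr ∈ distTriang T) : mu d (Tr.obj₃ ⟶ T₀) = kap d Tr.mor₂ + kap d Tr.mor₁ := by
  rw [mu_ker_range d (pre T₀ Tr.mor₂) (lenC_hom k d _)]
  have : LinearMap.range (pre T₀ Tr.mor₂) = LinearMap.ker (pre T₀ Tr.mor₁) := by
    ext x
    rw [LinearMap.mem_ker, LinearMap.mem_range]
    constructor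
    · rintro ⟨y, rfl⟩
      rw [pre_apply, pre_apply, ← Category.assoc, comp_distTriang_mor_zero₁₂ _ h, zero_comp]
    · intro hx
      obtain ⟨y, hy⟩ := Triangle.yoneda_exact₂ _ h x hx
      exact ⟨y, hy.symm⟩
  rw [this]; rfl

/-- the functional on objects -/
noncomputable def phiObj {X T₀ : T} (d : RD X T₀) (m : ℕ) (Y : T) : ZMod 2 :=
  ∑ i ∈ Finset.range m, mu d (Y⟦(i : ℤ)⟧ ⟶ T₀)

theorem cyc (m : ℕ) (F : ℕ → ZMod 2) (h : F m = F 0) :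
    ∑ i ∈ Finset.range m, F (i + 1) = ∑ i ∈ Finset.range m, F i := by
  have h1 := Finset.sum_range_succ F m
  rw [Finset.sum_range_succ' F m, h] at h1
  exact add_right_cancel h1

theorem kap_add {X T₀ : T} (d : RD X T₀) {U V : T} (f : U ⟶ V) (a b c : ℤ) (h : a + b = c) :
    kap d (f⟦a⟧'⟦b⟧') = kap d (f⟦c⟧') :=
  (kap_iso d _ _ ((shiftFunctorAdd' T a b c h).app U) ((shiftFunctorAdd' T a b c h).app V)
    (by simp)).symm

theorem mu_add {X T₀ : T} (d : RD X T₀) (U : T) (a b c : ℤ) (h : a + b = c) :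
    mu d (U⟦a⟧⟦b⟧ ⟶ T₀) = mu d (U⟦c⟧ ⟶ T₀) :=
  (mu_hom_iso d ((shiftFunctorAdd' T a b c h).app U)).symm

theorem phi_tri (k : Type*) [Field k] [CategoryTheory.Linear k T]
    [∀ X Y : T, FiniteDimensional k (X ⟶ Y)] {m : ℕ} (e : shiftFunctor T (m : ℤ) ≅ 𝟭 T)
    {X T₀ : T} (d : RD X T₀) (Tr : Triangle T) (h : Tr ∈ distTriang T) :
    phiObj d m Tr.obj₁ + phiObj d m Tr.obj₂ + phiObj d m Tr.obj₃ = 0 := by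
  let z : shiftFunctor T ((0 : ℕ) : ℤ) ≅ 𝟭 T := shiftFunctorZero T ℤ
  have hU : ∀ U : T, ∑ i ∈ Finset.range m, mu d (U⟦(1 : ℤ)⟧⟦(i : ℤ)⟧ ⟶ T₀) = phiObj d m U := by
    intro U
    rw [phiObj, ← cyc m (fun i => mu d (U⟦(i : ℤ)⟧ ⟶ T₀))]
    · apply Finset.sum_congr rfl
      intro i _
      exact mu_add d U _ _ _ (by push_cast; ring)
    · exact (mu_hom_iso d (e.app U)).trans (mu_hom_iso d (z.app U)).symm
  have hK : ∑ i ∈ Finset.range m, kap d (Tr.mor₁⟦(1 : ℤ)⟧'⟦(i : ℤ)⟧') =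
      ∑ i ∈ Finset.range m, kap d (Tr.mor₁⟦(i : ℤ)⟧') := by
    rw [← cyc m (fun i => kap d (Tr.mor₁⟦(i : ℤ)⟧'))]
    · apply Finset.sum_congr rfl
      intro i _
      exact kap_add d _ _ _ _ (by push_cast; ring)
    · exact (kap_iso d _ Tr.mor₁ (e.app _) (e.app _) (e.hom.naturality _)).trans
        (kap_iso d _ Tr.mor₁ (z.app _) (z.app _) (z.hom.naturality _)).symm
  have h1 : ∀ i : ℤ, mu d (Tr.obj₃⟦i⟧ ⟶ T₀) = kap d (Tr.mor₂⟦i⟧') + kap d (Tr.mor₁⟦i⟧') := by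
    intro i
    have := mu_tri k d _ (Triangle.shift_distinguished _ h i)
    rw [← kap_units d (Tr.mor₂⟦i⟧') i.negOnePow, ← kap_units d (Tr.mor₁⟦i⟧') i.negOnePow]
    exact this
  have h2 : ∀ i : ℤ, mu d (Tr.obj₁⟦(1 : ℤ)⟧⟦i⟧ ⟶ T₀) =
      kap d (Tr.mor₃⟦i⟧') + kap d (Tr.mor₂⟦i⟧') := by
    intro i
    have := mu_tri k d _ (Triangle.shift_distinguished _ (rot_of_distTriang _ h) i)
    rw [← kap_units d (Tr.mor₃⟦i⟧') i.negOnePow, ← kap_units d (Tr.mor₂⟦i⟧') i.negOnePow]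
    exact this
  have h3 : ∀ i : ℤ, mu d (Tr.obj₂⟦(1 : ℤ)⟧⟦i⟧ ⟶ T₀) =
      kap d (Tr.mor₁⟦(1 : ℤ)⟧'⟦i⟧') + kap d (Tr.mor₃⟦i⟧') := by
    intro i
    have := mu_tri k d _ (Triangle.shift_distinguished _
      (rot_of_distTriang _ (rot_of_distTriang _ h)) i)
    rw [← kap_units d (Tr.mor₃⟦i⟧') i.negOnePow, ← kap_neg d (Tr.mor₁⟦(1 : ℤ)⟧'⟦i⟧'),
      ← Functor.map_neg, ← kap_units d ((shiftFunctor T i).map _) i.negOnePow]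
    exact this
  rw [← hU Tr.obj₁, ← hU Tr.obj₂, phiObj]
  simp only [h1, h2, h3, Finset.sum_add_distrib, hK]
  have h2 : ∀ x : ZMod 2, x + x = 0 := by decide
  generalize (∑ i ∈ Finset.range m, kap d (Tr.mor₁⟦(i : ℤ)⟧')) = x
  generalize (∑ i ∈ Finset.range m, kap d (Tr.mor₂⟦(i : ℤ)⟧')) = y
  generalize (∑ i ∈ Finset.range m, kap d (Tr.mor₃⟦(i : ℤ)⟧')) = w
  linear_combination h2 x + h2 y + h2 w

theorem exists_phi (k : Type*) [Field k] [CategoryTheory.Linear k T]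
    [∀ X Y : T, FiniteDimensional k (X ⟶ Y)] {m : ℕ} (e : shiftFunctor T (m : ℤ) ≅ 𝟭 T)
    {X T₀ : T} (d : RD X T₀) :
    ∃ φ : K2 T →ₗ[ZMod 2] ZMod 2, ∀ Y, φ (cls Y) = phiObj d m Y := by
  let ψ : (T →₀ ZMod 2) →ₗ[ZMod 2] ZMod 2 := Finsupp.linearCombination (ZMod 2) (phiObj d m)
  have hψ : ∀ Y : T, ψ (Finsupp.single Y 1) = phiObj d m Y := by
    intro Y
    simp [ψ, Finsupp.linearCombination_single]
  refine ⟨(K2rel T).liftQ ψ ?_, ?_⟩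
  · rw [K2rel, Submodule.span_le]
    rintro _ ⟨Tr, h, rfl⟩
    change ψ _ = 0
    rw [map_add, map_add, hψ, hψ, hψ]
    exact phi_tri k e d Tr h
  · intro Y
    rw [← hψ]
    exact Submodule.liftQ_apply _ _ _

theorem phi_ret {m : ℕ} (hm : 0 < m) (e : shiftFunctor T (m : ℤ) ≅ 𝟭 T)
    {X T₀ : T} (d : RD X T₀) (hT : IsPeriodicTilting m T₀) (n : ℕ) (T' : T)
    (h : IsRet T' (⨁ fun _ : Fin n => T₀)) : phiObj d m T' = mu d (T' ⟶ T₀) := by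
  unfold phiObj
  rw [Finset.sum_eq_single_of_mem 0 (Finset.mem_range.2 hm)]
  · exact mu_hom_iso d ((shiftFunctorZero T ℤ).app T')
  · intro i hi hi0
    have hi' := Finset.mem_range.1 hi
    apply mu_triv
    change HV (T'⟦(i : ℤ)⟧) T₀
    have h1 : HV T' (T₀⟦((m - i : ℕ) : ℤ)⟧) := hv_ret hT n T' h _ (by omega) (by omega)
    have h2 := h1.shift (i : ℤ)
    refine h2.of_iso (Iso.refl _) ?_
    exact ((shiftFunctorAdd' T ((m - i : ℕ) : ℤ) (i : ℤ) (m : ℤ) (by omega)).app T₀).symm ≪≫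
      e.app T₀

end Func

open scoped ZeroObject

theorem pdLE_lt {A : Type*} [Category A] [Abelian A] : ∀ (n : ℕ) (X : A), pdLE A n X →
    HasProjectiveDimensionLT X (n + 1) := by
  intro n
  induction n with
  | zero =>
    intro X h
    exact projective_iff_hasProjectiveDimensionLT_one.1 h
  | succ n ih =>
    rintro X ⟨S, hS, hP, ⟨a⟩, h1⟩
    haveI := (hS.hasProjectiveDimensionLT_X₃_iff n hP).2 (ih _ h1)
    exact hasProjectiveDimensionLT_of_iso a _

section Fin
variable {T : Type u} [Category.{v} T] [HasZeroObject T] [Preadditive T] [HasShift T ℤ]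
    [∀ n : ℤ, (shiftFunctor T n).Additive] [Pretriangulated T]

theorem cls_biprod (A B : T) : cls (A ⊞ B) = cls A + cls B := by
  have h : cls A = cls (A ⊞ B) + cls B :=
    cls_tri_one _ (binaryBiproductTriangle_distinguished A B)
  rw [h, add_assoc, two_K2, add_zero]

theorem cls_ret (k : Type*) [Field k] [CategoryTheory.Linear k T]
    [∀ X Y : T, FiniteDimensional k (X ⟶ Y)] [IsIdempotentComplete T] (T₀ : T)
    (W : Submodule (ZMod 2) (K2 T))
    (hW : ∀ X : T, IsIndecomposable X → IsRet X T₀ → cls X ∈ W) (n : ℕ) :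
    ∀ T' : T, IsRet T' (⨁ fun _ : Fin n => T₀) → cls T' ∈ W := by
  apply ks_induct k
  · intro X hX _
    rw [cls_zero X hX]; exact W.zero_mem
  · intro X hX h
    obtain ⟨j, hj⟩ := isRet_biproduct k hX _ h
    exact hW X hX hj
  · intro X A B i p j q h1 h2 h3 h4 h5 hA hB hX
    let a : X ≅ A ⊞ B :=
      { hom := biprod.lift p q
        inv := biprod.desc i j
        hom_inv_id := by rw [biprod.lift_desc, h5]
        inv_hom_id := by
          apply biprod.hom_ext' <;> apply biprod.hom_ext <;> simp [h1, h2, h3, h4] }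
    rw [cls_iso a, cls_biprod]
    exact W.add_mem (hA (IsRet.trans ⟨i, p, h1⟩ hX)) (hB (IsRet.trans ⟨j, q, h2⟩ hX))

theorem K2_top (W : Submodule (ZMod 2) (K2 T)) (h : ∀ Y, cls Y ∈ W) : W = ⊤ := by
  rw [eq_top_iff]
  intro x _
  obtain ⟨y, rfl⟩ := (K2rel T).mkQ_surjective x
  induction y using Finsupp.induction_linear with
  | zero => rw [map_zero]; exact W.zero_mem
  | add a b ha hb => rw [map_add]; exact W.add_mem (ha trivial) (hb trivial)
  | single Y c =>
    have : Finsupp.single Y c = c • Finsupp.single Y (1 : ZMod 2) := by simp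
    rw [this, map_smul]
    exact W.smul_mem _ (h Y)

/-- The radical of `Hom(X, T₀)` -/
def radH (k : Type*) [Field k] [CategoryTheory.Linear k T]
    [∀ X Y : T, FiniteDimensional k (X ⟶ Y)] {X : T} (hX : IsIndecomposable X) (T₀ : T) :
    Submodule (End T₀) (X ⟶ T₀) where
  carrier := {f | ∀ g : T₀ ⟶ X, ¬ IsIso (f ≫ g)}
  add_mem' := by
    intro a b ha hb g h
    rw [Preadditive.add_comp] at h
    rcases indec_iso_or k hX _ _ h with h | h
    · exact ha g h
    · exact hb g h
  zero_mem' := by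
    intro g h
    rw [zero_comp] at h
    exact not_isIso_zero_of_indec hX h
  smul_mem' := by
    intro c f hf g h
    apply hf ((End.asHom c) ≫ g)
    rw [← Category.assoc]
    exact h

theorem mem_radH (k : Type*) [Field k] [CategoryTheory.Linear k T]
    [∀ X Y : T, FiniteDimensional k (X ⟶ Y)] {X : T} (hX : IsIndecomposable X) (T₀ : T)
    (f : X ⟶ T₀) : f ∈ radH k hX T₀ ↔ ∀ g : T₀ ⟶ X, ¬ IsIso (f ≫ g) := Iff.rfl

/-- the simple top -/
abbrev topH (k : Type*) [Field k] [CategoryTheory.Linear k T]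
    [∀ X Y : T, FiniteDimensional k (X ⟶ Y)] {X : T} (hX : IsIndecomposable X) (T₀ : T) : Type v :=
  (X ⟶ T₀) ⧸ radH k hX T₀

theorem mu_top_ne (k : Type*) [Field k] [CategoryTheory.Linear k T]
    [∀ X Y : T, FiniteDimensional k (X ⟶ Y)] {X X' : T} (hX : IsIndecomposable X)
    (hX' : IsIndecomposable X') {T₀ : T} (d : RD X' T₀) (hne : ¬ Nonempty (X ≅ X')) :
    mu d (topH k hX T₀) = 0 := by
  have hz : ∀ x : Crn d (topH k hX T₀), x = 0 := by
    intro x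
    apply Subtype.ext
    rw [← (mem_crn d _).1 x.2]
    obtain ⟨f, hf⟩ := (radH k hX T₀).mkQ_surjective x
    rw [← hf, ← map_smul]
    refine (Submodule.Quotient.mk_eq_zero _).2 ?_
    intro g hg
    apply hne
    have hg' : IsIso ((f ≫ d.r) ≫ (d.i ≫ g)) := by
      have : (f ≫ d.r) ≫ (d.i ≫ g) = (f ≫ d.r ≫ 𝟙 X' ≫ d.i) ≫ g := by simp
      rw [this]; exact hg
    exact (isRet_of_isIso _ _ hg').iso hX hX'
  haveI : Subsingleton (Crn d (topH k hX T₀)) := ⟨fun a b => (hz a).trans (hz b).symm⟩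
  unfold mu lenC
  rw [Module.length_eq_zero]; simp

theorem iso_left {X : T} (hX : IsIndecomposable X) (a c : X ⟶ X) (h : IsIso (a ≫ c)) : IsIso a := by
  have h1 : a ≫ c ≫ inv (a ≫ c) = 𝟙 X := by rw [← Category.assoc, IsIso.hom_inv_id]
  rcases hX.2 ((c ≫ inv (a ≫ c)) ≫ a) (by
    simp only [Category.assoc]; rw [reassoc_of% h1]) with h0 | h0
  · exfalso
    apply indec_id_ne hX
    have : (a ≫ c ≫ inv (a ≫ c)) ≫ (a ≫ c ≫ inv (a ≫ c)) = 0 := by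
      simp only [Category.assoc] at h0 ⊢
      rw [reassoc_of% h0]; simp
    rw [h1] at this
    simpa using this
  · exact ⟨c ≫ inv (a ≫ c), h1, h0⟩

theorem mu_top_eq (k : Type*) [Field k] [CategoryTheory.Linear k T]
    [∀ X Y : T, FiniteDimensional k (X ⟶ Y)] {X : T} (hX : IsIndecomposable X)
    {T₀ : T} (d : RD X T₀) :
    mu d (topH k hX T₀) = 1 := by
  have hnt : Nontrivial (Crn d (topH k hX T₀)) := by
    refine ⟨⟨⟨(radH k hX T₀).mkQ d.i, ?_⟩, 0, ?_⟩⟩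
    · rw [mem_crn, ← map_smul]
      congr 1
      change d.i ≫ d.r ≫ 𝟙 X ≫ d.i = d.i
      simp [reassoc_of% d.h]
    · intro h
      have h1 : (radH k hX T₀).mkQ d.i = 0 := congrArg Subtype.val h
      have h2 : d.i ∈ radH k hX T₀ := (Submodule.Quotient.mk_eq_zero _).1 h1
      apply h2 d.r
      rw [d.h]; infer_instance
  have hs : IsSimpleModule (End X) (Crn d (topH k hX T₀)) := by
    rw [isSimpleModule_iff_toSpanSingleton_surjective]
    refine ⟨hnt, fun x hx y => ?_⟩
    obtain ⟨f, hf⟩ := (radH k hX T₀).mkQ_surjective x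
    obtain ⟨f', hf'⟩ := (radH k hX T₀).mkQ_surjective y
    have ha : IsIso (f ≫ d.r) := by
      by_contra hcon
      apply hx
      apply Subtype.ext
      rw [← (mem_crn d _).1 x.2, ← hf, ← map_smul]
      refine (Submodule.Quotient.mk_eq_zero _).2 ?_
      intro g hg
      apply hcon
      apply iso_left hX _ (d.i ≫ g)
      have : (f ≫ d.r) ≫ (d.i ≫ g) = (f ≫ d.r ≫ 𝟙 X ≫ d.i) ≫ g := by simp
      rw [this]; exact hg
    refine ⟨End.of (inv (f ≫ d.r) ≫ f' ≫ d.r), ?_⟩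
    rw [LinearMap.toSpanSingleton_apply]
    apply Subtype.ext
    rw [crn_smul_coe, ← (mem_crn d _).1 y.2, ← hf, ← hf', ← map_smul, ← map_smul]
    congr 1
    change f ≫ d.r ≫ (inv (f ≫ d.r) ≫ f' ≫ d.r) ≫ d.i = f' ≫ d.r ≫ 𝟙 X ≫ d.i
    have h1 : f ≫ d.r ≫ inv (f ≫ d.r) = 𝟙 X := by rw [← Category.assoc, IsIso.hom_inv_id]
    simp only [Category.assoc, Category.id_comp]
    rw [reassoc_of% h1]
  unfold mu lenC
  rw [Module.length_eq_one]; simp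

theorem vec_mem (k : Type*) [Field k] [CategoryTheory.Linear k T]
    [∀ X Y : T, FiniteDimensional k (X ⟶ Y)] [IsIdempotentComplete T]
    {m : ℕ} (hm : 0 < m) (e : shiftFunctor T (m : ℤ) ≅ 𝟭 T) {T₀ : T}
    (hT : IsPeriodicTilting m T₀) {I : Type*} (R : I → T) (d : ∀ S, RD (R S) T₀)
    (Φ : K2 T →ₗ[ZMod 2] (I → ZMod 2)) (hΦ : ∀ Y S, Φ (cls Y) S = phiObj (d S) m Y) :
    ∀ (n : ℕ) (M : ModuleCat.{v} (End T₀)), Module.Finite (End T₀) M →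
      HasProjectiveDimensionLT M (n + 1) → (fun S => mu (d S) M) ∈ LinearMap.range Φ := by
  have hret : ∀ n T', IsRet T' (⨁ fun _ : Fin n => T₀) →
      (fun S => mu (d S) (T' ⟶ T₀)) ∈ LinearMap.range Φ := by
    intro n T' h
    refine ⟨cls T', ?_⟩
    funext S
    rw [hΦ, phi_ret hm e (d S) hT n T' h]
  intro n
  induction n with
  | zero =>
    intro M hfin hpd
    haveI : Projective M := projective_iff_hasProjectiveDimensionLT_one.2 hpd
    haveI : Module.Projective (End T₀) M := (IsProjective.iff_projective (R := End T₀) M).2 this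
    obtain ⟨n, T', hr, ⟨θ⟩⟩ := proj_repr T₀ M
    have := hret n T' hr
    simp only [mu_equiv (d _) θ] at this
    exact this
  | succ n ih =>
    intro M hfin hpd
    obtain ⟨N, p, hp⟩ := exists_surj T₀ M
    haveI := isScalarTower_end k (⨁ fun _ : Fin N => T₀) T₀
    haveI : IsNoetherian (End T₀) ((⨁ fun _ : Fin N => T₀) ⟶ T₀) :=
      isNoetherian_of_tower k inferInstance
    let S : ShortComplex (ModuleCat.{v} (End T₀)) :=
      ShortComplex.mk (X₁ := ModuleCat.of.{v} (End T₀) (LinearMap.ker p))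
        (X₂ := ModuleCat.of.{v} (End T₀) ((⨁ fun _ : Fin N => T₀) ⟶ T₀)) (X₃ := M)
        (ModuleCat.ofHom (LinearMap.ker p).subtype) (ModuleCat.ofHom p) (by
          ext a
          exact a.2)
    have hS : S.ShortExact := by
      refine ShortComplex.ShortExact.mk' ?_ ?_ ?_
      · rw [ShortComplex.moduleCat_exact_iff]
        intro a ha
        exact ⟨⟨a, ha⟩, rfl⟩
      · rw [ModuleCat.mono_iff_injective]
        exact Submodule.injective_subtype _
      · rw [ModuleCat.epi_iff_surjective]
        exact hp
    have hP : Projective S.X₂ := by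
      apply (IsProjective.iff_projective (R := End T₀) _).1
      exact proj_bip T₀ N
    have hK := ih (ModuleCat.of.{v} (End T₀) (LinearMap.ker p)) inferInstance
      ((hS.hasProjectiveDimensionLT_X₃_iff n hP).1 hpd)
    have hB := hret N (⨁ fun _ : Fin N => T₀) ⟨𝟙 _, 𝟙 _, by simp⟩
    have h2 : ∀ x : ZMod 2, x + x = 0 := by decide
    have := Submodule.add_mem _ hK hB
    convert this using 1
    funext S
    have h3 := mu_exact (d S) (LinearMap.ker p).subtype p (Submodule.injective_subtype _) hp
      (by rw [LinearMap.exact_iff, Submodule.range_subtype]) (lenC_hom k (d S) _)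
    rw [Pi.add_apply, h3, ← add_assoc]
    change _ = mu (d S) (LinearMap.ker p) + mu (d S) (LinearMap.ker p) + _
    rw [h2, zero_add]

theorem count_eq (k : Type*) [Field k] [CategoryTheory.Linear k T]
    [∀ X Y : T, FiniteDimensional k (X ⟶ Y)] [IsIdempotentComplete T]
    {m : ℕ} (hm : 0 < m) (e : shiftFunctor T (m : ℤ) ≅ 𝟭 T) {T₀ : T}
    (hT : IsStrictPeriodicTilting m T₀) :
    summandCount T₀ = Module.finrank (ZMod 2) (K2 T) := by
  classical
  obtain ⟨hT, hst⟩ := hT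
  have hpd : ∀ M : ModuleCat.{v} (End T₀), HasProjectiveDimensionLT M m := by
    intro M
    have := pdLE_lt _ _ (hst M)
    rwa [Nat.sub_add_cancel hm] at this
  have hfin := finite_indec_ret k T₀
  let I := {S : _root_.Quotient (CategoryTheory.isIsomorphicSetoid T) //
    ∃ X : T, IsIndecomposable X ∧ (∃ (i : X ⟶ T₀) (r : T₀ ⟶ X), i ≫ r = 𝟙 X) ∧
      isoClass X = S}
  haveI : Finite I := hfin.to_subtype
  haveI : Fintype I := Fintype.ofFinite I
  have hcount : summandCount T₀ = Fintype.card I := Nat.card_eq_fintype_card (α := I)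
  have hI : ∀ S : I, ∃ X : T, IsIndecomposable X ∧
    (∃ (i : X ⟶ T₀) (r : T₀ ⟶ X), i ≫ r = 𝟙 X) ∧ isoClass X = S.1 := fun S => S.2
  choose R hR hret hRS using hI
  choose i r hir using hret
  let d : ∀ S, RD (R S) T₀ := fun S => ⟨i S, r S, hir S⟩
  have hspan : Submodule.span (ZMod 2) (Set.range fun S => cls (R S)) = ⊤ := by
    apply K2_top
    apply span_all k hm e hT _ hpd
    intro n
    apply cls_ret k
    intro X hX hXr
    let S : I := ⟨isoClass X, X, hX, hXr, rfl⟩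
    have hiso : Nonempty (X ≅ R S) := Quotient.exact (hRS S).symm
    obtain ⟨a⟩ := hiso
    rw [cls_iso a]
    exact Submodule.subset_span ⟨S, rfl⟩
  haveI : Module.Finite (ZMod 2) (K2 T) :=
    ⟨⟨(Set.finite_range fun S => cls (R S)).toFinset, by simpa using hspan⟩⟩
  choose φ hφ using fun S => exists_phi k e (d S)
  let Φ : K2 T →ₗ[ZMod 2] (I → ZMod 2) := LinearMap.pi φ
  have hvec := vec_mem k hm e hT R d Φ (fun Y S => hφ S Y)
  have hsurj : LinearMap.range Φ = ⊤ := by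
    rw [eq_top_iff, ← (Pi.basisFun (ZMod 2) I).span_eq, Submodule.span_le]
    rintro _ ⟨S, rfl⟩
    haveI := finite_hom k (R S) T₀
    have h1 := hvec (m - 1) (ModuleCat.of.{v} (End T₀) (topH k (hR S) T₀)) inferInstance
      (by rw [Nat.sub_add_cancel hm]; exact hpd _)
    rw [SetLike.mem_coe]
    convert h1 using 1
    funext S'
    rw [Pi.basisFun_apply]
    by_cases hSS : S' = S
    · subst hSS
      rw [Pi.single_eq_same]
      exact (mu_top_eq k (hR S') (d S')).symm
    · rw [Pi.single_eq_of_ne hSS]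
      refine (mu_top_ne k (hR S) (hR S') (d S') ?_).symm
      intro hiso
      apply hSS
      apply Subtype.ext
      rw [← hRS, ← hRS]
      exact (Quotient.sound hiso).symm
  rw [hcount]
  apply le_antisymm
  · have := LinearMap.finrank_range_le Φ
    rwa [hsurj, finrank_top, Module.finrank_fintype_fun_eq_card] at this
  · have := finrank_range_le_card (R := ZMod 2) (fun S => cls (R S))
    rwa [Set.finrank, hspan, finrank_top] at this

end Fin

/-- Let `T` be an idempotent complete algebraic `m`-periodic triangulated
category over a perfect field `k` with finite dimensional Hom-spaces.  Then any two strict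
`m`-periodic tilting objects of `T` have the same number of pairwise non-isomorphic
indecomposable direct summands. -/
theorem strict_periodic_tilting_summandCount_eq
    (k : Type*) [Field k] [PerfectField k]
    (T : Type u) [Category.{v} T] [HasZeroObject T] [Preadditive T] [HasShift T ℤ]
    [∀ n : ℤ, (shiftFunctor T n).Additive] [Pretriangulated T]
    [CategoryTheory.Linear k T] [IsIdempotentComplete T]
    [∀ X Y : T, FiniteDimensional k (X ⟶ Y)]
    (halg : IsAlgebraicTriangulated T)
    (m : ℕ) (hm₀ : 0 < m)
    (e : shiftFunctor T (m : ℤ) ≅ 𝟭 T)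
    (T₁ T₂ : T)
    (h₁ : IsStrictPeriodicTilting m T₁) (h₂ : IsStrictPeriodicTilting m T₂) :
    summandCount T₁ = summandCount T₂ := by
  exact (count_eq k hm₀ e h₁).trans (count_eq k hm₀ e h₂).symm
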